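/- Let G be a three-player LTL game (Ag = {1,2,3}) with empty strong core, and let {a,b,c} be a permutation of {1,2,3}. Then there do not exist strategies σ_a for player a, σ_b for player b, and σ_c, σ'_c for player c such that all of the following hold: the run of (σ_a, σ_b, σ_c) satisfies γ_a and γ_b but not γ_c; the run of (σ_a, σ_b, σ'_c) satisfies γ_c only; and σ'_c is a strong beneficial deviation for {c} from (σ_a, σ_b, σ_c). -/

import Mathlib

/-- A concurrent game structure over a set of agents `Ag`, states `St`, and,
for each agent `i`, a set of actions `Ac i`.  It consists of an initial state
and a transition function. -/
structure CGS (Ag St : Type) (Ac : Ag → Type) where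
  init : St
  tr : St → (∀ i, Ac i) → St

/-- A strategy for a player with actions `A`: it maps finite (nonempty)
histories of states, given as lists, to an action. -/
abbrev Strategy (St A : Type) := List St → A

/-- A strategy profile: one strategy for each player. -/
abbrev Profile {Ag : Type} (St : Type) (Ac : Ag → Type) := ∀ i, Strategy St (Ac i)

namespace CGS

variable {Ag St : Type} {Ac : Ag → Type}

/-- The history `ρ(σ)[0 … t]` (as a list) together with the current state
`ρ(σ)[t]` of the run induced by a strategy profile `σ`. -/
def histRun (M : CGS Ag St Ac) (σ : Profile St Ac) : ℕ → List St × St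
  | 0 => ([M.init], M.init)
  | t + 1 =>
      let p := histRun M σ t
      let s := M.tr p.2 (fun i => σ i p.1)
      (p.1 ++ [s], s)

/-- The unique run `ρ(σ)` induced by a strategy profile `σ`. -/
def run (M : CGS Ag St Ac) (σ : Profile St Ac) (t : ℕ) : St :=
  (histRun M σ t).2

/-- A run of `M`: an infinite state sequence starting at the initial state in
which every step is obtained by some action profile. -/
def IsRun (M : CGS Ag St Ac) (ρ : ℕ → St) : Prop :=
  ρ 0 = M.init ∧ ∀ t, ∃ a : ∀ i, Ac i, ρ (t + 1) = M.tr (ρ t) a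

end CGS

open Classical in
/-- Combine a joint strategy `σC` for a coalition `C` with strategies `σN`
for the players outside `C`, obtaining a full strategy profile. -/
noncomputable def combine {Ag St : Type} {Ac : Ag → Type} (C : Set Ag)
    (σC : ∀ i ∈ C, Strategy St (Ac i)) (σN : ∀ i ∉ C, Strategy St (Ac i)) :
    Profile St Ac :=
  fun i => if h : i ∈ C then σC i h else σN i h

/-- Syntax of Linear Temporal Logic over atomic propositions `AP`:
atoms, negation, disjunction, next, and until. -/
inductive LTLFormula (AP : Type) where
  | atom : AP → LTLFormula AP
  | neg  : LTLFormula AP → LTLFormula AP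
  | disj : LTLFormula AP → LTLFormula AP → LTLFormula AP
  | next : LTLFormula AP → LTLFormula AP
  | untl : LTLFormula AP → LTLFormula AP → LTLFormula AP

/-- Standard LTL semantics over infinite runs `ρ : ℕ → St`, via a labelling
function `lab : St → Set AP`. -/
def LTLFormula.Sat {AP St : Type} (lab : St → Set AP) :
    LTLFormula AP → (ℕ → St) → Prop
  | .atom p, ρ => p ∈ lab (ρ 0)
  | .neg φ, ρ => ¬ LTLFormula.Sat lab φ ρ
  | .disj φ ψ, ρ => LTLFormula.Sat lab φ ρ ∨ LTLFormula.Sat lab ψ ρ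
  | .next φ, ρ => LTLFormula.Sat lab φ (fun t => ρ (t + 1))
  | .untl φ ψ, ρ =>
      ∃ j : ℕ, LTLFormula.Sat lab ψ (fun t => ρ (t + j)) ∧
        ∀ k < j, LTLFormula.Sat lab φ (fun t => ρ (t + k))

/-- An LTL game: a concurrent game structure together with a labelling
function and an LTL goal for each player. -/
structure LTLGame (Ag St : Type) (Ac : Ag → Type) (AP : Type) where
  M : CGS Ag St Ac
  lab : St → Set AP
  goal : Ag → LTLFormula AP

namespace LTLGame

variable {Ag St AP : Type} {Ac : Ag → Type}

/-- The winners of a run: players whose goal is satisfied by the run. -/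
def winners (G : LTLGame Ag St Ac AP) (ρ : ℕ → St) : Set Ag :=
  {i | (G.goal i).Sat G.lab ρ}

/-- `σC` is a beneficial deviation for the (nonempty) coalition `C` from the
strategy profile `σ`: every member of `C` loses under `σ`, and all members of
`C` win under `(σC, σN)` no matter which joint strategy `σN` the remaining
players use. -/
def BeneficialDeviation (G : LTLGame Ag St Ac AP) (C : Set Ag)
    (σ : Profile St Ac) (σC : ∀ i ∈ C, Strategy St (Ac i)) : Prop :=
  C.Nonempty ∧
  C ⊆ (G.winners (G.M.run σ))ᶜ ∧
  ∀ σN : ∀ i ∉ C, Strategy St (Ac i), C ⊆ G.winners (G.M.run (combine C σC σN))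

/-- A strategy profile is in the core iff no coalition has a beneficial
deviation from it. -/
def inCore (G : LTLGame Ag St Ac AP) (σ : Profile St Ac) : Prop :=
  ∀ (C : Set Ag) (σC : ∀ i ∈ C, Strategy St (Ac i)),
    ¬ G.BeneficialDeviation C σ σC

/-- A (nonempty) coalition `C` is fulfilled if it has a joint strategy
guaranteeing all goals of its members, against every joint strategy of the
remaining players. -/
def Fulfilled (G : LTLGame Ag St Ac AP) (C : Set Ag) : Prop :=
  C.Nonempty ∧
  ∃ σC : ∀ i ∈ C, Strategy St (Ac i),
    ∀ σN : ∀ i ∉ C, Strategy St (Ac i),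
      C ⊆ G.winners (G.M.run (combine C σC σN))

/-- `σC` is a strong beneficial deviation for the (nonempty) coalition `C`
from `σ`: (1) all members of `C` lose under `σ`; (2) all members of `C` win
under `(σ₋C, σC)`; (3) against every counter joint strategy `σN` under which
all original winners still win, all members of `C` win. -/
def StrongBeneficialDeviation (G : LTLGame Ag St Ac AP) (C : Set Ag)
    (σ : Profile St Ac) (σC : ∀ i ∈ C, Strategy St (Ac i)) : Prop :=
  C.Nonempty ∧
  C ⊆ (G.winners (G.M.run σ))ᶜ ∧
  C ⊆ G.winners (G.M.run (combine C σC (fun i _ => σ i))) ∧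
  ∀ σN : ∀ i ∉ C, Strategy St (Ac i),
    G.winners (G.M.run σ) ⊆ G.winners (G.M.run (combine C σC σN)) →
      C ⊆ G.winners (G.M.run (combine C σC σN))

/-- A strategy profile is in the strong core iff no coalition has a strong
beneficial deviation from it. -/
def inStrongCore (G : LTLGame Ag St Ac AP) (σ : Profile St Ac) : Prop :=
  ∀ (C : Set Ag) (σC : ∀ i ∈ C, Strategy St (Ac i)),
    ¬ G.StrongBeneficialDeviation C σ σC

/-- `(G, φ) ∈ E-Core` iff some member of the core of `G` induces a run
satisfying `φ`. -/
def ECore (G : LTLGame Ag St Ac AP) (φ : LTLFormula AP) : Prop :=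
  ∃ σ : Profile St Ac, G.inCore σ ∧ φ.Sat G.lab (G.M.run σ)

end LTLGame

theorem combine_eq_of_forall_mem {Ag St : Type} {Ac : Ag → Type} (C : Set Ag)
    (σC : ∀ i ∈ C, Strategy St (Ac i)) (σ ρ : Profile St Ac)
    (h : ∀ i ∈ C, ρ i = combine C σC (fun i _ => σ i) i) :
    combine C σC (fun i _ => ρ i) = ρ := by
  funext i
  by_cases hi : i ∈ C
  · rw [h i hi]
    simp [combine, hi]
  · simp [combine, hi]

section ThreePlayers

variable {S : Fin 3 → Type}

/-- `σ'` is a strong beneficial deviation of the single player `i` from `σ`, where `W` assigns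
to each profile its set of winners. -/
def LoneDeviation (W : (∀ i, S i) → Set (Fin 3)) (i : Fin 3) (σ σ' : ∀ i, S i) : Prop :=
  i ∉ W σ ∧ i ∈ W σ' ∧ (∀ j, j ≠ i → σ' j = σ j) ∧
    ∀ ρ : ∀ i, S i, ρ i = σ' i → W σ ⊆ W ρ → i ∈ W ρ

/-- The losers `i` and `j` of `σ` can both win by changing only their own strategies. -/
def PairCanWin (W : (∀ i, S i) → Set (Fin 3)) (i j : Fin 3) (σ : ∀ i, S i) : Prop :=
  i ∉ W σ ∧ j ∉ W σ ∧ ∃ σ' : ∀ i, S i, i ∈ W σ' ∧ j ∈ W σ' ∧ ∀ k, k ≠ i → k ≠ j → σ' k = σ k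

/-- Every profile admits a lone deviation or a pair of losers that can jointly win. -/
def AlwaysUnstable (W : (∀ i, S i) → Set (Fin 3)) : Prop :=
  ∀ σ : ∀ i, S i, (∃ i σ', LoneDeviation W i σ σ') ∨ ∃ i j, i ≠ j ∧ PairCanWin W i j σ

theorem AlwaysUnstable.cases {W : (∀ i, S i) → Set (Fin 3)} (h : AlwaysUnstable W)
    {a b c : Fin 3} (hab : a ≠ b) (hac : a ≠ c) (hbc : b ≠ c) (σ : ∀ i, S i) :
    (∃ σ', LoneDeviation W a σ σ') ∨ (∃ σ', LoneDeviation W b σ σ') ∨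
      (∃ σ', LoneDeviation W c σ σ') ∨
      PairCanWin W a b σ ∨ PairCanWin W a c σ ∨ PairCanWin W b c σ := by
  have cover : ∀ i : Fin 3, i = a ∨ i = b ∨ i = c := by omega
  have swap : ∀ i j, PairCanWin W i j σ → PairCanWin W j i σ := by
    rintro i j ⟨hi, hj, σ', hi', hj', hk⟩
    exact ⟨hj, hi, σ', hj', hi', fun k h₁ h₂ => hk k h₂ h₁⟩
  rcases h σ with ⟨i, hi⟩ | ⟨i, j, hij, hp⟩
  · rcases cover i with rfl | rfl | rfl <;> simp [hi]
  · have hp' := swap i j hp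
    rcases cover i with rfl | rfl | rfl <;> rcases cover j with rfl | rfl | rfl <;> simp_all

theorem subset_of_notMem_of_forall {a b c : Fin 3} (hab : a ≠ b) (hac : a ≠ c) (hbc : b ≠ c)
    {X Y : Set (Fin 3)} (ha : a ∉ X) (hb : b ∈ X → b ∈ Y) (hc : c ∈ X → c ∈ Y) : X ⊆ Y := by
  intro i hi
  have cover : i = a ∨ i = b ∨ i = c := by omega
  rcases cover with rfl | rfl | rfl <;> tauto

/-- The constraint that a lone deviation imposes, in terms of the two other players. -/
theorem LoneDeviation.elim {W : (∀ i, S i) → Set (Fin 3)} {a b c : Fin 3} (hab : a ≠ b)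
    (hac : a ≠ c) (hbc : b ≠ c) {σ σ' : ∀ i, S i} (h : LoneDeviation W a σ σ') :
    a ∉ W σ ∧ a ∈ W σ' ∧ σ' b = σ b ∧ σ' c = σ c ∧
      ∀ ρ : ∀ i, S i, ρ a = σ' a → (b ∈ W σ → b ∈ W ρ) → (c ∈ W σ → c ∈ W ρ) → a ∈ W ρ :=
  ⟨h.1, h.2.1, h.2.2.1 b hab.symm, h.2.2.1 c hac.symm, fun ρ hρ hb hc =>
    h.2.2.2 ρ hρ (subset_of_notMem_of_forall hab hac hbc h.1 hb hc)⟩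

theorem PairCanWin.elim {W : (∀ i, S i) → Set (Fin 3)} {a b c : Fin 3}
    (hac : a ≠ c) (hbc : b ≠ c) {σ : ∀ i, S i} (h : PairCanWin W a b σ) :
    a ∉ W σ ∧ b ∉ W σ ∧ ∃ σ' : ∀ i, S i, a ∈ W σ' ∧ b ∈ W σ' ∧ σ' c = σ c :=
  let ⟨ha, hb, σ', ha', hb', h'⟩ := h
  ⟨ha, hb, σ', ha', hb', h' c hac.symm hbc.symm⟩

/-- `AlwaysUnstable.cases` with the deviations spelled out. -/
theorem AlwaysUnstable.spell {W : (∀ i, S i) → Set (Fin 3)} (h : AlwaysUnstable W)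
    {a b c : Fin 3} (hab : a ≠ b) (hac : a ≠ c) (hbc : b ≠ c) (σ : ∀ i, S i) :
    (∃ σ' : ∀ i, S i, a ∉ W σ ∧ a ∈ W σ' ∧ σ' b = σ b ∧ σ' c = σ c ∧
      ∀ ρ : ∀ i, S i, ρ a = σ' a → (b ∈ W σ → b ∈ W ρ) → (c ∈ W σ → c ∈ W ρ) → a ∈ W ρ) ∨
    (∃ σ' : ∀ i, S i, b ∉ W σ ∧ b ∈ W σ' ∧ σ' a = σ a ∧ σ' c = σ c ∧
      ∀ ρ : ∀ i, S i, ρ b = σ' b → (a ∈ W σ → a ∈ W ρ) → (c ∈ W σ → c ∈ W ρ) → b ∈ W ρ) ∨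
    (∃ σ' : ∀ i, S i, c ∉ W σ ∧ c ∈ W σ' ∧ σ' a = σ a ∧ σ' b = σ b ∧
      ∀ ρ : ∀ i, S i, ρ c = σ' c → (a ∈ W σ → a ∈ W ρ) → (b ∈ W σ → b ∈ W ρ) → c ∈ W ρ) ∨
    (a ∉ W σ ∧ b ∉ W σ ∧ ∃ σ' : ∀ i, S i, a ∈ W σ' ∧ b ∈ W σ' ∧ σ' c = σ c) ∨
    (a ∉ W σ ∧ c ∉ W σ ∧ ∃ σ' : ∀ i, S i, a ∈ W σ' ∧ c ∈ W σ' ∧ σ' b = σ b) ∨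
    (b ∉ W σ ∧ c ∉ W σ ∧ ∃ σ' : ∀ i, S i, b ∈ W σ' ∧ c ∈ W σ' ∧ σ' a = σ a) := by
  rcases h.cases hab hac hbc σ with ⟨σ', h⟩ | ⟨σ', h⟩ | ⟨σ', h⟩ | h | h | h
  · exact .inl ⟨σ', h.elim hab hac hbc⟩
  · exact .inr (.inl ⟨σ', h.elim hab.symm hbc hac⟩)
  · exact .inr (.inr (.inl ⟨σ', h.elim hac.symm hbc.symm hab⟩))
  · exact .inr (.inr (.inr (.inl (h.elim hac hbc))))
  · exact .inr (.inr (.inr (.inr (.inl (h.elim hab hbc.symm)))))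
  · exact .inr (.inr (.inr (.inr (.inr (h.elim hab.symm hac.symm)))))

variable {W : (∀ i, S i) → Set (Fin 3)} {a b c : Fin 3}

/-- If the strategy `σ c` rules out that `a` and `b` both win and `b` loses under `σ`, then
player `a` has no lone deviation from `σ`. -/
theorem AlwaysUnstable.not_loneDeviation (h : AlwaysUnstable W)
    (hab : a ≠ b) (hac : a ≠ c) (hbc : b ≠ c)
    (hall : ∀ ρ, a ∈ W ρ → b ∈ W ρ → c ∈ W ρ → False)
    {σ σ₁ : ∀ i, S i} (hc : ∀ ρ : ∀ i, S i, ρ c = σ c → a ∈ W ρ → b ∈ W ρ → False)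
    (hσb : b ∉ W σ) : ¬ LoneDeviation W a σ σ₁ := by
  intro hdev
  obtain ⟨-, ha₁, -, hc₁, hca⟩ := hdev.elim hab hac hbc
  replace hca : ∀ ρ : ∀ i, S i, ρ a = σ₁ a → c ∈ W ρ → a ∈ W ρ :=
    fun ρ hρ hcρ => hca ρ hρ (fun hb => absurd hb hσb) (fun _ => hcρ)
  have hb₁ : b ∉ W σ₁ := fun hb => hc σ₁ hc₁ ha₁ hb
  by_cases hcW : c ∈ W σ₁
  · -- winners of `σ₁` are `a` and `c`
    obtain ⟨σ₂, -, hb₂, haa₂, hcc₂, hd₂⟩ :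
        ∃ σ₂ : ∀ i, S i, b ∉ W σ₁ ∧ b ∈ W σ₂ ∧ σ₂ a = σ₁ a ∧ σ₂ c = σ₁ c ∧
          ∀ ρ : ∀ i, S i, ρ b = σ₂ b → a ∈ W ρ → c ∈ W ρ → False := by
      rcases h.spell hab hac hbc σ₁ with H | H | H | H | H | H <;> grind
    have ha₂ : a ∉ W σ₂ := by grind
    have hc₂ : c ∉ W σ₂ := by grind
    obtain ⟨σ₃, ha₃, hbb₃, hcc₃, hd₃⟩ :
        ∃ σ₃ : ∀ i, S i, a ∈ W σ₃ ∧ σ₃ b = σ₂ b ∧ σ₃ c = σ₂ c ∧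
          ∀ ρ : ∀ i, S i, ρ a = σ₃ a → b ∈ W ρ → a ∈ W ρ := by
      rcases h.spell hab hac hbc σ₂ with H | H | H | H | H | H <;> grind
    have hb₃ : b ∉ W σ₃ := by grind
    have hc₃ : c ∉ W σ₃ := by grind
    obtain ⟨σ₄, hc₄, haa₄, hbb₄, hd₄⟩ :
        ∃ σ₄ : ∀ i, S i, c ∈ W σ₄ ∧ σ₄ a = σ₃ a ∧ σ₄ b = σ₃ b ∧
          ∀ ρ : ∀ i, S i, ρ c = σ₄ c → a ∈ W ρ → c ∈ W ρ := by
      rcases h.spell hab hac hbc σ₃ with H | H | H | H | H | H <;> grind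
    have ha₄ : a ∉ W σ₄ := by grind
    have hb₄ : b ∉ W σ₄ := by grind
    rcases h.spell hab hac hbc σ₄ with H | H | H | H | H | H <;> grind
  · -- `a` is the only winner of `σ₁`
    have hsplit : (∃ σ₂ : ∀ i, S i, b ∈ W σ₂ ∧ σ₂ a = σ₁ a ∧ σ₂ c = σ₁ c ∧
          ∀ ρ : ∀ i, S i, ρ b = σ₂ b → a ∈ W ρ → b ∈ W ρ) ∨
        (∃ σ₂ : ∀ i, S i, c ∈ W σ₂ ∧ σ₂ a = σ₁ a ∧
          ∀ ρ : ∀ i, S i, ρ c = σ₂ c → a ∈ W ρ → c ∈ W ρ) := by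
      rcases h.spell hab hac hbc σ₁ with H | H | H | H | H | H <;> grind
    rcases hsplit with ⟨σ₂, hb₂, haa₂, hcc₂, hd₂⟩ | ⟨σ₂, hc₂, haa₂, hd₂⟩
    · have ha₂ : a ∉ W σ₂ := by grind
      have hc₂ : c ∉ W σ₂ := by grind
      rcases h.spell hab hac hbc σ₂ with H | H | H | H | H | H <;> grind
    · have ha₂ : a ∈ W σ₂ := by grind
      have hb₂ : b ∉ W σ₂ := by grind
      obtain ⟨σ₃, hb₃, haa₃, hcc₃, hd₃⟩ :
          ∃ σ₃ : ∀ i, S i, b ∈ W σ₃ ∧ σ₃ a = σ₂ a ∧ σ₃ c = σ₂ c ∧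
            ∀ ρ : ∀ i, S i, ρ b = σ₃ b → a ∈ W ρ → c ∈ W ρ → False := by
        rcases h.spell hab hac hbc σ₂ with H | H | H | H | H | H <;> grind
      have ha₃ : a ∉ W σ₃ := by grind
      have hc₃ : c ∉ W σ₃ := by grind
      rcases h.spell hab hac hbc σ₃ with H | H | H | H | H | H <;> grind

end ThreePlayers

namespace LTLGame

variable {St AP : Type} {Ac : Fin 3 → Type}

theorem StrongBeneficialDeviation.loneDeviation {G : LTLGame (Fin 3) St Ac AP} {C : Set (Fin 3)}
    {σ : Profile St Ac} {σC : ∀ i ∈ C, Strategy St (Ac i)}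
    (h : G.StrongBeneficialDeviation C σ σC) {i : Fin 3} (hC : C = {i}) :
    LoneDeviation (fun σ => G.winners (G.M.run σ)) i σ (combine C σC (fun i _ => σ i)) := by
  have hi : i ∈ C := by simp [hC]
  refine ⟨h.2.1 hi, h.2.2.1 hi, fun j hj => ?_, fun ρ hρ hW => ?_⟩
  · simp [combine, hC, hj]
  · have key : combine C σC (fun i _ => ρ i) = ρ := by
      apply combine_eq_of_forall_mem C σC σ
      intro j hj
      obtain rfl : j = i := by simpa [hC] using hj
      exact hρ
    have := h.2.2.2 (fun i _ => ρ i)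
    rw [key] at this
    exact this hW hi

theorem not_all_win {G : LTLGame (Fin 3) St Ac AP}
    (hempty : ∀ σ : Profile St Ac,
      ∃ (C : Set (Fin 3)) (σC : ∀ i ∈ C, Strategy St (Ac i)), G.StrongBeneficialDeviation C σ σC)
    (σ : Profile St Ac) : ∃ i, i ∉ G.winners (G.M.run σ) := by
  obtain ⟨C, σC, ⟨i, hi⟩, hl, -⟩ := hempty σ
  exact ⟨i, hl hi⟩

theorem alwaysUnstable {G : LTLGame (Fin 3) St Ac AP}
    (hempty : ∀ σ : Profile St Ac,
      ∃ (C : Set (Fin 3)) (σC : ∀ i ∈ C, Strategy St (Ac i)),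
        G.StrongBeneficialDeviation C σ σC) :
    AlwaysUnstable (fun σ : Profile St Ac => G.winners (G.M.run σ)) := by
  intro σ
  obtain ⟨C, σC, h⟩ := hempty σ
  obtain ⟨i, hi⟩ := h.1
  by_cases hC : C = {i}
  · exact .inl ⟨i, _, h.loneDeviation hC⟩
  · obtain ⟨j, hj, hji⟩ : ∃ j ∈ C, j ≠ i := by
      by_contra! hne
      exact hC (Set.eq_singleton_iff_unique_mem.2 ⟨hi, hne⟩)
    refine .inr ⟨i, j, hji.symm, h.2.1 hi, h.2.1 hj, _, h.2.2.1 hi, h.2.2.1 hj, ?_⟩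
    intro k hki hkj
    have hk : k ∉ C := by
      intro hk
      obtain ⟨l, hl⟩ := not_all_win hempty (combine C σC (fun i _ => σ i))
      have cover : l = i ∨ l = j ∨ l = k := by omega
      rcases cover with rfl | rfl | rfl <;> exact hl (h.2.2.1 ‹_›)
    simp [combine, hk]

end LTLGame

/-- Let `G` be a three-player LTL game with empty strong core,
and `{a,b,c}` a permutation of the three players.  Then there are no profiles
`τ = (σ_a, σ_b, σ_c)` and `τ' = (σ_a, σ_b, σ'_c)` such that: `ρ(τ)` satisfies
`γ_a` and `γ_b` but not `γ_c`; `ρ(τ')` satisfies `γ_c` only; and `σ'_c` is a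
strong beneficial deviation for `{c}` from `τ`. -/
theorem no_lone_deviation_from_two_winners_of_empty_strongCore
    {St AP : Type} {Ac : Fin 3 → Type}
    [Fintype St] [∀ i, Fintype (Ac i)] [∀ i, Nonempty (Ac i)] [Fintype AP]
    (G : LTLGame (Fin 3) St Ac AP)
    (hempty : ∀ σ : Profile St Ac,
      ∃ (C : Set (Fin 3)) (σC : ∀ i ∈ C, Strategy St (Ac i)),
        G.StrongBeneficialDeviation C σ σC)
    (a b c : Fin 3) (hab : a ≠ b) (hac : a ≠ c) (hbc : b ≠ c) :
    ¬ ∃ τ τ' : Profile St Ac,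
        -- `τ' = (σ_a, σ_b, σ'_c)` differs from `τ = (σ_a, σ_b, σ_c)` only at `c`
        τ' a = τ a ∧ τ' b = τ b ∧
        -- `ρ(τ)` satisfies `γ_a` and `γ_b` but not `γ_c`
        ((G.goal a).Sat G.lab (G.M.run τ) ∧ (G.goal b).Sat G.lab (G.M.run τ) ∧
          ¬ (G.goal c).Sat G.lab (G.M.run τ)) ∧
        -- `ρ(τ')` satisfies `γ_c` only
        ((G.goal c).Sat G.lab (G.M.run τ') ∧ ¬ (G.goal a).Sat G.lab (G.M.run τ') ∧
          ¬ (G.goal b).Sat G.lab (G.M.run τ')) ∧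
        -- `σ'_c` is a strong beneficial deviation for `{c}` from `τ`
        G.StrongBeneficialDeviation {c} τ (fun i _ => τ' i) := by
  rintro ⟨τ, τ', -, -, -, ⟨hc', ha', hb'⟩, hdev⟩
  set W : Profile St Ac → Set (Fin 3) := fun σ => G.winners (G.M.run σ)
  have hU : AlwaysUnstable W := LTLGame.alwaysUnstable hempty
  have hall : ∀ ρ, a ∈ W ρ → b ∈ W ρ → c ∈ W ρ → False := by
    intro ρ h₁ h₂ h₃
    obtain ⟨i, hi⟩ := LTLGame.not_all_win hempty ρ
    have cover : i = a ∨ i = b ∨ i = c := by omega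
    rcases cover with rfl | rfl | rfl <;> exact hi ‹_›
  have hcstrat : ∀ ρ : Profile St Ac, ρ c = τ' c → a ∈ W ρ → b ∈ W ρ → False := by
    intro ρ hρ h₁ h₂
    have hlone := (hdev.loneDeviation rfl).elim hac.symm hbc.symm hab
    refine hall ρ h₁ h₂ (hlone.2.2.2.2 ρ ?_ (fun _ => h₁) (fun _ => h₂))
    simp [combine, hρ]
  rcases hU.cases hab hac hbc τ' with ⟨σ', H⟩ | ⟨σ', H⟩ | ⟨σ', H⟩ | H | H | H
  · exact hU.not_loneDeviation hab hac hbc hall hcstrat hb' H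
  · exact hU.not_loneDeviation hab.symm hbc hac (fun ρ h₁ h₂ => hall ρ h₂ h₁)
      (fun ρ hρ h₁ h₂ => hcstrat ρ hρ h₂ h₁) ha' H
  · exact H.1 hc'
  · obtain ⟨-, -, σ', h₁, h₂, h₃⟩ := H.elim hac hbc
    exact hcstrat σ' h₃ h₁ h₂
  · exact H.2.1 hc'
  · exact H.2.1 hc'
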